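/- Let k ≥ 2 and let B : 𝔽₂^k × 𝔽₂^k → ℤ be a matrix such that: for every x ∈ 𝔽₂^k, the row (B(x,u))_u takes values in {0, +2^{k−1}, −2^{k−1}}, its support {u : B(x,u) ≠ 0} is a coset of a 2-dimensional linear subspace of 𝔽₂^k, and the number of u with B(x,u) = +2^{k−1} is odd; and the same three conditions hold for every column (B(x,u))_x with u fixed. Then there exists a bent function f : 𝔽₂^k × 𝔽₂^k → 𝔽₂ in 2k variables such that ∑_{u ∈ 𝔽₂^k} B(x,u)(−1)^{⟨y,u⟩} = 2^k · (−1)^{f(x,y)} for all x, y ∈ 𝔽₂^k (i.e., B is the bent square of f). -/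

import Mathlib

/-- `𝔽₂ⁿ`, the space of binary vectors of length `n`. -/
abbrev BV (n : ℕ) : Type := Fin n → ZMod 2

/-- The inner product `⟨x, y⟩ = ⊕ᵢ xᵢ yᵢ` on `𝔽₂ⁿ`. -/
def ip {n : ℕ} (x y : BV n) : ZMod 2 := ∑ i, x i * y i

/-- The Walsh transform `W_f(y) = ∑_{x} (−1)^{f(x) ⊕ ⟨x,y⟩}` of a Boolean function. -/
def walsh {n : ℕ} (f : BV n → ZMod 2) (y : BV n) : ℤ :=
  ∑ x : BV n, (-1 : ℤ) ^ ((f x + ip x y).val)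

/-- A Boolean function in `n` variables (`n` even) is bent if `|W_f(y)| = 2^{n/2}`
for all `y`. -/
def IsBent (n : ℕ) (f : BV n → ZMod 2) : Prop :=
  ∀ y : BV n, |walsh f y| = 2 ^ (n / 2)

/-- `b_n`, the number of bent functions in `n` variables. -/
noncomputable def bentCount (n : ℕ) : ℕ :=
  Nat.card {f : BV n → ZMod 2 // IsBent n f}

/-- The Walsh transform of a Boolean function in `2k` variables, viewed as a
function on `𝔽₂^k × 𝔽₂^k`. -/
def walsh2 {k : ℕ} (f : BV k × BV k → ZMod 2) (u v : BV k) : ℤ :=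
  ∑ x : BV k, ∑ y : BV k, (-1 : ℤ) ^ ((f (x, y) + ip x u + ip y v).val)

/-- A Boolean function in `2k` variables is bent if `|W_f(u,v)| = 2^k` for all
`(u,v)`. -/
def IsBent2 (k : ℕ) (f : BV k × BV k → ZMod 2) : Prop :=
  ∀ u v : BV k, |walsh2 f u v| = 2 ^ k

/-- The bent square of `f`: `B(x,u) = ∑_y (−1)^{f(x,y) ⊕ ⟨y,u⟩}`. -/
def bentSq {k : ℕ} (f : BV k × BV k → ZMod 2) (x u : BV k) : ℤ :=
  ∑ y : BV k, (-1 : ℤ) ^ ((f (x, y) + ip y u).val)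

/-- `S` is a coset of a 2-dimensional linear subspace of `𝔽₂^k`. -/
def IsCoset2 {k : ℕ} (S : Set (BV k)) : Prop :=
  ∃ W : Submodule (ZMod 2) (BV k), Module.finrank (ZMod 2) W = 2 ∧
    ∃ a : BV k, S = {v | ∃ w ∈ W, v = a + w}

/-- The sign character `z ↦ (−1)^z` on `𝔽₂`. -/
def signChar (z : ZMod 2) : ℤ := (-1 : ℤ) ^ z.val

lemma signChar_add (a b : ZMod 2) : signChar (a + b) = signChar a * signChar b := by
  revert a b; decide

lemma signChar_eq (a : ZMod 2) : signChar a = 1 ∨ signChar a = -1 := by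
  revert a; decide

lemma ip_comm {n : ℕ} (x y : BV n) : ip x y = ip y x := by
  simp [ip, mul_comm]

lemma ip_add_left {n : ℕ} (x y z : BV n) : ip (x + y) z = ip x z + ip y z := by
  simp [ip, add_mul, Finset.sum_add_distrib]

lemma ip_add_right {n : ℕ} (x y z : BV n) : ip x (y + z) = ip x y + ip x z := by
  simp [ip, mul_add, Finset.sum_add_distrib]

lemma BV.add_eq_zero_iff {n : ℕ} (x y : BV n) : x + y = 0 ↔ x = y := by
  simp only [funext_iff, Pi.add_apply, Pi.zero_apply, CharTwo.add_eq_zero]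

lemma sum_signChar_ip {n : ℕ} (w : BV n) :
    ∑ y : BV n, signChar (ip y w) = if w = 0 then 2 ^ n else 0 := by
  split_ifs with h
  · subst h
    simp [ip, signChar, ZMod.card]
  · obtain ⟨i, hi⟩ : ∃ i, w i ≠ 0 := by
      by_contra! hc
      exact h (funext hc)
    have hi1 : w i = 1 := by
      revert hi
      generalize w i = z
      revert z
      decide
    have hs : ip (Pi.single i 1) w = 1 := by
      simp [ip, Pi.single_apply, hi1]
    have key : ∑ y : BV n, signChar (ip (y + Pi.single i 1) w)
        = ∑ y : BV n, signChar (ip y w) :=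
      Fintype.sum_equiv (Equiv.addRight (Pi.single i 1)) _ _ fun _ => rfl
    have h1 : signChar 1 = -1 := by decide
    simp only [ip_add_left, signChar_add, hs, h1, mul_neg, mul_one,
      Finset.sum_neg_distrib] at key
    linarith

/-- Fourier inversion on `𝔽₂ⁿ`. -/
lemma sum_sum_signChar_ip {n : ℕ} (φ : BV n → ℤ) (v : BV n) :
    ∑ y : BV n, (∑ u : BV n, φ u * signChar (ip y u)) * signChar (ip y v) = 2 ^ n * φ v := by
  simp_rw [Finset.sum_mul]
  rw [Finset.sum_comm]
  have h : ∀ u : BV n, ∑ y : BV n, φ u * signChar (ip y u) * signChar (ip y v)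
      = if u = v then 2 ^ n * φ v else 0 := by
    intro u
    simp_rw [mul_assoc, ← signChar_add, ← ip_add_right]
    rw [← Finset.mul_sum, sum_signChar_ip]
    simp only [BV.add_eq_zero_iff]
    split_ifs with huv
    · rw [huv, mul_comm]
    · simp
  simp [h]

lemma IsCoset2.exists_eq {k : ℕ} {S : Set (BV k)} (hS : IsCoset2 S) :
    ∃ a p q : BV k, p ≠ 0 ∧ q ≠ 0 ∧ p ≠ q ∧
      ∀ v, v ∈ S ↔ v = a ∨ v = a + p ∨ v = a + q ∨ v = a + (p + q) := by
  obtain ⟨W, hW, a, rfl⟩ := hS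
  let b : Module.Basis (Fin 2) (ZMod 2) W := Module.finBasisOfFinrankEq _ _ hW
  refine ⟨a, b 0, b 1, ?_, ?_, ?_, ?_⟩
  · simpa using b.ne_zero 0
  · simpa using b.ne_zero 1
  · intro h
    exact absurd (b.injective (Subtype.ext h)) (by decide)
  · intro v
    constructor
    · rintro ⟨w, hw, rfl⟩
      have hr := congrArg Subtype.val (b.sum_repr ⟨w, hw⟩)
      simp only [Fin.sum_univ_two, Submodule.coe_add, Submodule.coe_smul] at hr
      have h01 : ∀ z : ZMod 2, z = 0 ∨ z = 1 := by decide
      rcases h01 (b.repr ⟨w, hw⟩ 0) with h0 | h0 <;>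
      rcases h01 (b.repr ⟨w, hw⟩ 1) with h1 | h1 <;>
      rw [h0, h1] at hr <;> simp at hr <;> simp [← hr]
    · rintro (rfl | rfl | rfl | rfl)
      · exact ⟨0, W.zero_mem, by simp⟩
      · exact ⟨_, (b 0).2, rfl⟩
      · exact ⟨_, (b 1).2, rfl⟩
      · exact ⟨_, W.add_mem (b 0).2 (b 1).2, rfl⟩

/-- A function supported on a 2-dimensional coset, with values `±2^{k−1}` there and an odd
number of positive values, has all its Fourier coefficients equal to `±2^k`. -/
lemma exists_sum_eq_signChar {k : ℕ} (hk : 2 ≤ k) (φ : BV k → ℤ)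
    (hval : ∀ u, φ u = 0 ∨ φ u = 2 ^ (k - 1) ∨ φ u = -(2 ^ (k - 1)))
    (hsupp : IsCoset2 {u | φ u ≠ 0})
    (hodd : Odd (Nat.card {u : BV k // φ u = 2 ^ (k - 1)})) (y : BV k) :
    ∃ e : ZMod 2, ∑ u : BV k, φ u * signChar (ip y u) = 2 ^ k * signChar e := by
  obtain ⟨a, p, q, hp, hq, hpq, hS⟩ := hsupp.exists_eq
  simp only [Set.mem_ofPred_eq] at hS
  have hpq' : p + q ≠ 0 := by
    rwa [Ne, BV.add_eq_zero_iff]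
  have hsum : ∀ g : BV k → ℤ, (∀ u, φ u = 0 → g u = 0) →
      ∑ u, g u = g a + g (a + p) + g (a + q) + g (a + (p + q)) := by
    intro g hg
    rw [← Finset.sum_subset (Finset.subset_univ {a, a + p, a + q, a + (p + q)})]
    · rw [Finset.sum_insert, Finset.sum_insert, Finset.sum_pair]
      · ring
      all_goals simp [hp, hq, hpq, hpq']
    · intro u _ hu
      apply hg
      by_contra h
      apply hu
      simpa using (hS u).1 h
  have hc : (2 : ℤ) ^ k = 2 * 2 ^ (k - 1) := by
    rw [← pow_succ']
    congr 1
    omega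
  have hcpos : (0 : ℤ) < 2 ^ (k - 1) := by positivity
  rw [hc]
  generalize (2 : ℤ) ^ (k - 1) = c at *
  have hcard : (Nat.card {u : BV k // φ u = c} : ℤ) = ∑ u, if φ u = c then 1 else 0 := by
    rw [Nat.card_eq_fintype_card, Fintype.card_subtype]
    simp
  rw [hsum _ (fun u hu => by simp [hu, hcpos.ne])] at hcard
  have hodd' : Odd (Nat.card {u : BV k // φ u = c} : ℤ) := by exact_mod_cast hodd
  rw [hcard] at hodd'
  rw [hsum _ (fun u hu => by simp [hu])]
  have hv : ∀ u, (u = a ∨ u = a + p ∨ u = a + q ∨ u = a + (p + q)) → φ u = c ∨ φ u = -c :=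
    fun u hu => (hval u).resolve_left ((hS u).2 hu)
  have hne : -c ≠ c := by omega
  simp only [ip_add_right, signChar_add]
  suffices h : ∃ s : ℤ, (s = 1 ∨ s = -1) ∧
      φ a * signChar (ip y a) + φ (a + p) * (signChar (ip y a) * signChar (ip y p)) +
        φ (a + q) * (signChar (ip y a) * signChar (ip y q)) +
        φ (a + (p + q)) * (signChar (ip y a) * (signChar (ip y p) * signChar (ip y q)))
        = 2 * c * s by
    obtain ⟨s, rfl | rfl, h⟩ := h
    · exact ⟨0, h⟩
    · exact ⟨1, h⟩
  rcases hv a (by simp) with h1 | h1 <;> rcases hv (a + p) (by simp) with h2 | h2 <;>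
  rcases hv (a + q) (by simp) with h3 | h3 <;> rcases hv (a + (p + q)) (by simp) with h4 | h4 <;>
  simp only [h1, h2, h3, h4, hne, if_true, if_false] at hodd' ⊢ <;>
  first
  | exact absurd hodd' (by decide)
  | rcases signChar_eq (ip y a) with e1 | e1 <;> rcases signChar_eq (ip y p) with e2 | e2 <;>
    rcases signChar_eq (ip y q) with e3 | e3 <;> rw [e1, e2, e3] <;>
    first
    | exact ⟨1, Or.inl rfl, by ring1⟩
    | exact ⟨-1, Or.inr rfl, by ring1⟩

/-- if every row and every column of `B : 𝔽₂^k × 𝔽₂^k → ℤ`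
(`k ≥ 2`) takes values in `{0, ±2^{k−1}}`, has support a coset of a
2-dimensional linear subspace, and has an odd number of entries `+2^{k−1}`,
then `B` is the bent square of some bent function `f` in `2k` variables. -/
theorem stmt_14 (k : ℕ) (hk : 2 ≤ k) (B : BV k → BV k → ℤ)
    (hrow : ∀ x : BV k,
      (∀ u, B x u = 0 ∨ B x u = 2 ^ (k - 1) ∨ B x u = -(2 ^ (k - 1))) ∧
      IsCoset2 {u | B x u ≠ 0} ∧
      Odd (Nat.card {u : BV k // B x u = 2 ^ (k - 1)}))
    (hcol : ∀ u : BV k,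
      (∀ x, B x u = 0 ∨ B x u = 2 ^ (k - 1) ∨ B x u = -(2 ^ (k - 1))) ∧
      IsCoset2 {x | B x u ≠ 0} ∧
      Odd (Nat.card {x : BV k // B x u = 2 ^ (k - 1)})) :
    ∃ f : BV k × BV k → ZMod 2, IsBent2 k f ∧
      ∀ x y : BV k,
        ∑ u : BV k, B x u * (-1 : ℤ) ^ ((ip y u).val)
          = 2 ^ k * (-1 : ℤ) ^ ((f (x, y)).val) := by
  choose g hg using fun x y =>
    exists_sum_eq_signChar hk (B x) (hrow x).1 (hrow x).2.1 (hrow x).2.2 y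
  refine ⟨fun z => g z.1 z.2, fun u v => ?_, hg⟩
  have hB : ∀ x, ∑ y, signChar (g x y) * signChar (ip y v) = B x v := by
    intro x
    have h := sum_sum_signChar_ip (B x) v
    simp_rw [hg, mul_assoc, ← Finset.mul_sum] at h
    exact mul_left_cancel₀ (by positivity) h
  have hw : walsh2 (fun z => g z.1 z.2) u v = ∑ x, B x v * signChar (ip u x) := by
    change ∑ x, ∑ y, signChar (g x y + ip x u + ip y v) = _
    refine Finset.sum_congr rfl fun x _ => ?_
    rw [← hB x, Finset.sum_mul]
    refine Finset.sum_congr rfl fun y _ => ?_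
    rw [signChar_add, signChar_add, ip_comm x u]
    ring
  obtain ⟨e, he⟩ := exists_sum_eq_signChar hk (fun x => B x v)
    (hcol v).1 (hcol v).2.1 (hcol v).2.2 u
  rw [hw, he]
  rcases signChar_eq e with h | h <;> simp [h]
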